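/- First moment of the Henyey–Greenstein phase function: for every anisotropy factor η ∈ (−1, 1) and every s ∈ S², the vector-valued integral ∫_{S²} (1/(4π)) · (1 − η²) · (1 + η² − 2η ⟨s, s'⟩)^{−3/2} · s' dσ(s') equals η s, where ⟨s, s'⟩ is the Euclidean inner product in ℝ³. -/

import Mathlib

open MeasureTheory Metric Real
open scoped ENNReal RealInnerProductSpace

noncomputable section

/-- The ambient Euclidean space `ℝ³`. -/
abbrev E3 := EuclideanSpace ℝ (Fin 3)

/-- The unit sphere `S² ⊆ ℝ³`. -/
abbrev S2 := Metric.sphere (0 : E3) 1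

/-- The surface measure on the unit sphere `S²`. -/
def sphereMeasure : Measure S2 := (volume : Measure E3).toSphere

/-- The Henyey–Greenstein scattering phase function with anisotropy factor `η`. -/
def henyeyGreenstein (η : ℝ) (s s' : S2) : ℝ :=
  (1 / (4 * π)) * (1 - η ^ 2) *
    (1 + η ^ 2 - 2 * η * ⟪(s : E3), (s' : E3)⟫) ^ (-(3 : ℝ) / 2)

/-- Integration in polar coordinates of the product of a radial and an angular function. -/
lemma integral_norm_smul_normalize {E F : Type*} [NormedAddCommGroup E] [NormedSpace ℝ E]
    [MeasurableSpace E] [BorelSpace E] [FiniteDimensional ℝ E] [Nontrivial E]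
    [NormedAddCommGroup F] [NormedSpace ℝ F] (μ : Measure E) [μ.IsAddHaarMeasure]
    (h : ℝ → ℝ) (f : E → F) :
    ∫ x, h ‖x‖ • f (‖x‖⁻¹ • x) ∂μ =
      (∫ r in Set.Ioi (0 : ℝ), r ^ (Module.finrank ℝ E - 1) * h r) • ∫ u, f u ∂μ.toSphere := by
  calc
    ∫ x, h ‖x‖ • f (‖x‖⁻¹ • x) ∂μ
      = ∫ x : ({(0)}ᶜ : Set E), h ‖x.1‖ • f (‖x.1‖⁻¹ • x.1) ∂(μ.comap (↑)) := by
      rw [integral_subtype_comap (measurableSet_singleton _).compl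
        fun x ↦ h ‖x‖ • f (‖x‖⁻¹ • x), restrict_compl_singleton]
    _ = ∫ x, h x.2 • f x.1 ∂μ.toSphere.prod (.volumeIoiPow (Module.finrank ℝ E - 1)) := by
      simpa using μ.measurePreserving_homeomorphUnitSphereProd.integral_comp
        (Homeomorph.measurableEmbedding _) (fun x ↦ h x.2 • f x.1)
    _ = (∫ r : Set.Ioi (0 : ℝ), h r ∂.volumeIoiPow (Module.finrank ℝ E - 1)) •
          ∫ u, f u ∂μ.toSphere := by
      rw [← integral_prod_swap]
      exact integral_prod_smul (fun r : Set.Ioi (0 : ℝ) ↦ h r)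
        (fun u : sphere (0 : E) 1 ↦ f u)
    _ = _ := by
      congr 1
      simp only [Measure.volumeIoiPow, ENNReal.ofReal]
      rw [integral_withDensity_eq_integral_smul,
        integral_subtype_comap measurableSet_Ioi
          fun a ↦ Real.toNNReal (a ^ (Module.finrank ℝ E - 1)) • h a,
        setIntegral_congr_fun measurableSet_Ioi fun x hx ↦ ?_]
      · rw [NNReal.smul_def, Real.coe_toNNReal _ (pow_nonneg hx.out.le _), smul_eq_mul]
      · exact (measurable_subtype_coe.pow_const _).real_toNNReal

lemma integral_Ioi_pow_mul_exp_neg_sq (n : ℕ) :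
    ∫ r in Set.Ioi (0 : ℝ), r ^ n * exp (-r ^ 2) = Gamma ((n + 1) / 2) / 2 := by
  have h := integral_rpow_mul_exp_neg_rpow (p := 2) (q := n) two_pos
    (neg_one_lt_zero.trans_le n.cast_nonneg)
  simp only [rpow_natCast, rpow_two] at h
  rw [h]
  ring

lemma integral_pow_mul_exp_neg_sq_of_even {n : ℕ} (hn : Even n) :
    ∫ x : ℝ, x ^ n * exp (-x ^ 2) = Gamma ((n + 1) / 2) := by
  have h := integral_comp_abs (f := fun x ↦ x ^ n * exp (-x ^ 2))
  simp only [hn.pow_abs, sq_abs] at h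
  rw [h, integral_Ioi_pow_mul_exp_neg_sq]
  ring

lemma integral_pow_mul_exp_neg_sq_of_odd {n : ℕ} (hn : Odd n) :
    ∫ x : ℝ, x ^ n * exp (-x ^ 2) = 0 := by
  have h := integral_neg_eq_self (fun x : ℝ ↦ x ^ n * exp (-x ^ 2)) volume
  simp only [hn.neg_pow, neg_sq, neg_mul, integral_neg] at h
  linarith

/-- A Gaussian integral over `ℝ³` of a power of a linear form reduces to one over `ℝ`. -/
lemma integral_inner_pow_mul_exp_neg_norm_sq (s : S2) (n : ℕ) :
    ∫ x : E3, ⟪(s : E3), x⟫ ^ n * exp (-‖x‖ ^ 2) = π * ∫ x : ℝ, x ^ n * exp (-x ^ 2) := by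
  have hs : ‖(s : E3)‖ = 1 := norm_eq_of_mem_sphere s
  obtain ⟨b, hb⟩ := Orthonormal.exists_orthonormalBasis_extension_of_card_eq
    (𝕜 := ℝ) (E := E3) (ι := Fin 3) (by simp) (v := fun _ ↦ (s : E3)) (s := {0})
    ⟨fun _ ↦ hs, fun i j hij ↦ (hij (Subsingleton.elim i j)).elim⟩
  have hb0 : b 0 = s := hb 0 rfl
  have hgauss : ∫ x : ℝ, exp (-x ^ 2) = √π := by simpa using integral_gaussian 1
  calc
    ∫ x : E3, ⟪(s : E3), x⟫ ^ n * exp (-‖x‖ ^ 2)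
      = ∫ x : E3, (b.repr x 0) ^ n * exp (-‖b.repr x‖ ^ 2) := by
      simp [b.repr_apply_apply, hb0]
    _ = ∫ y : E3, (y 0) ^ n * exp (-‖y‖ ^ 2) :=
      b.measurePreserving_repr.integral_comp b.repr.toHomeomorph.measurableEmbedding
        (fun y : E3 ↦ (y 0) ^ n * exp (-‖y‖ ^ 2))
    _ = ∫ y : Fin 3 → ℝ, (y 0) ^ n * exp (-‖(WithLp.toLp 2 y : E3)‖ ^ 2) :=
      ((PiLp.volume_preserving_toLp (Fin 3)).integral_comp
        (MeasurableEquiv.toLp 2 (Fin 3 → ℝ)).measurableEmbedding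
        (fun y : E3 ↦ (y 0) ^ n * exp (-‖y‖ ^ 2))).symm
    _ = ∫ y : Fin 3 → ℝ, ∏ i, (if i = 0 then y i ^ n else 1) * exp (-y i ^ 2) := by
      congr 1 with y
      simp only [EuclideanSpace.norm_sq_eq, Fin.sum_univ_three, Fin.prod_univ_three, neg_add,
        exp_add, norm_eq_abs, sq_abs, if_true, one_ne_zero, if_false, Fin.reduceEq, one_mul]
      ring
    _ = _ := by
      rw [integral_fintype_prod_volume_eq_prod
        (fun (i : Fin 3) (t : ℝ) ↦ (if i = 0 then t ^ n else 1) * exp (-t ^ 2))]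
      simp only [Fin.prod_univ_three, if_true, one_ne_zero, if_false, Fin.reduceEq, one_mul, hgauss]
      rw [mul_assoc, mul_self_sqrt pi_pos.le, mul_comm]

lemma integral_inner_pow_sphereMeasure (s : S2) (n : ℕ) :
    ∫ u, ⟪(s : E3), (u : E3)⟫ ^ n ∂sphereMeasure = 2 * π * ∫ t in (-1 : ℝ)..1, t ^ n := by
  have hpolar := integral_norm_smul_normalize (volume : Measure E3)
    (fun r ↦ r ^ n * exp (-r ^ 2)) (fun x ↦ ⟪(s : E3), x⟫ ^ n)
  have hleft : ∀ x : E3, (‖x‖ ^ n * exp (-‖x‖ ^ 2)) • ⟪(s : E3), ‖x‖⁻¹ • x⟫ ^ n =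
      ⟪(s : E3), x⟫ ^ n * exp (-‖x‖ ^ 2) := by
    intro x
    have : ‖x‖ * ⟪(s : E3), ‖x‖⁻¹ • x⟫ = ⟪(s : E3), x⟫ := by
      rcases eq_or_ne x 0 with rfl | hx
      · simp
      · rw [real_inner_smul_right, mul_inv_cancel_left₀ (norm_ne_zero_iff.2 hx)]
    rw [← this, mul_pow, smul_eq_mul]
    ring
  have hright : ∀ r : ℝ, r ^ (Module.finrank ℝ E3 - 1) * (r ^ n * exp (-r ^ 2)) =
      r ^ (n + 2) * exp (-r ^ 2) := by
    intro r
    simp only [finrank_euclideanSpace, Fintype.card_fin]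
    ring
  simp only [hleft, hright] at hpolar
  rw [integral_inner_pow_mul_exp_neg_norm_sq, integral_Ioi_pow_mul_exp_neg_sq, smul_eq_mul] at hpolar
  have hn : (0 : ℝ) < (n + 1) / 2 := by positivity
  have hΓ := Gamma_pos_of_pos hn
  have hstep : Gamma (((n + 2 : ℕ) + 1) / 2) = (n + 1) / 2 * Gamma ((n + 1) / 2) := by
    rw [← Gamma_add_one hn.ne']
    congr 1
    push_cast
    ring
  rw [hstep] at hpolar
  rw [sphereMeasure, integral_pow]
  rcases n.even_or_odd with h | h
  · rw [integral_pow_mul_exp_neg_sq_of_even h] at hpolar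
    rw [h.add_one.neg_pow]
    refine mul_left_cancel₀ (mul_pos (mul_pos hn hΓ) (half_pos one_pos)).ne' ?_
    rw [one_pow]
    field_simp
    field_simp at hpolar
    linarith
  · rw [integral_pow_mul_exp_neg_sq_of_odd h, mul_zero] at hpolar
    rw [h.add_one.neg_pow, one_pow, sub_self, zero_div, mul_zero]
    refine (mul_eq_zero.1 hpolar.symm).resolve_left (by positivity)

lemma inner_mem_Icc (s u : S2) : ⟪(s : E3), (u : E3)⟫ ∈ Set.Icc (-1 : ℝ) 1 := by
  have h := abs_real_inner_le_norm (s : E3) (u : E3)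
  rw [norm_eq_of_mem_sphere s, norm_eq_of_mem_sphere u, one_mul] at h
  exact abs_le.1 h

instance : IsFiniteMeasure sphereMeasure := inferInstanceAs (IsFiniteMeasure (Measure.toSphere _))

lemma integrable_sphereMeasure {F : Type*} [NormedAddCommGroup F] {f : S2 → F}
    (hf : Continuous f) : Integrable f sphereMeasure :=
  hf.integrable_of_hasCompactSupport (HasCompactSupport.of_compactSpace f)

lemma continuous_comp_inner {f : ℝ → ℝ} (hf : ContinuousOn f (Set.Icc (-1) 1)) (s : S2) :
    Continuous fun u : S2 ↦ f ⟪(s : E3), (u : E3)⟫ :=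
  hf.comp_continuous (by fun_prop) (inner_mem_Icc s)

lemma integral_polynomial_inner_sphereMeasure (s : S2) (p : Polynomial ℝ) :
    ∫ u, p.eval ⟪(s : E3), (u : E3)⟫ ∂sphereMeasure = 2 * π * ∫ t in (-1 : ℝ)..1, p.eval t := by
  induction p using Polynomial.induction_on' with
  | add p q hp hq =>
    simp only [Polynomial.eval_add]
    rw [integral_add (integrable_sphereMeasure (continuous_comp_inner p.continuousOn s))
      (integrable_sphereMeasure (continuous_comp_inner q.continuousOn s)),
      intervalIntegral.integral_add (p.continuous.intervalIntegrable _ _)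
      (q.continuous.intervalIntegrable _ _), hp, hq, mul_add]
  | monomial n a =>
    simp only [Polynomial.eval_monomial]
    rw [integral_const_mul, intervalIntegral.integral_const_mul, integral_inner_pow_sphereMeasure]
    ring

/-- Archimedes' hat-box theorem: the orthogonal projection of the surface measure of `S²` to an
axis is `2π` times the Lebesgue measure on `[-1, 1]`. -/
lemma integral_comp_inner_sphereMeasure (s : S2) {f : ℝ → ℝ}
    (hf : ContinuousOn f (Set.Icc (-1) 1)) :
    ∫ u, f ⟪(s : E3), (u : E3)⟫ ∂sphereMeasure = 2 * π * ∫ t in (-1 : ℝ)..1, f t := by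
  set C := sphereMeasure.real Set.univ + 2 * π * 2 with hC
  have hC0 : 0 < C := by positivity
  refine eq_of_forall_dist_le fun ε hε ↦ ?_
  obtain ⟨p, hp⟩ := exists_polynomial_near_of_continuousOn (-1) 1 f hf (ε / C) (div_pos hε hC0)
  have hsphere : |∫ u, f ⟪(s : E3), (u : E3)⟫ ∂sphereMeasure -
      ∫ u, p.eval ⟪(s : E3), (u : E3)⟫ ∂sphereMeasure| ≤ ε / C * sphereMeasure.real Set.univ := by
    rw [← integral_sub (integrable_sphereMeasure (continuous_comp_inner hf s))
      (integrable_sphereMeasure (continuous_comp_inner p.continuousOn s)), ← norm_eq_abs]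
    refine norm_integral_le_of_norm_le_const (.of_forall fun u ↦ ?_)
    rw [norm_eq_abs, abs_sub_comm]
    exact (hp _ (inner_mem_Icc s u)).le
  have hinterval : |(∫ t in (-1 : ℝ)..1, p.eval t) - ∫ t in (-1 : ℝ)..1, f t| ≤ ε / C * 2 := by
    rw [← intervalIntegral.integral_sub (p.continuous.intervalIntegrable _ _)
      (hf.intervalIntegrable_of_Icc (by norm_num)), ← norm_eq_abs]
    refine (intervalIntegral.norm_integral_le_of_norm_le_const (C := ε / C) fun t ht ↦ ?_).trans_eq
      (by norm_num)
    rw [Set.uIoc_of_le (by norm_num)] at ht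
    exact (hp t (Set.Ioc_subset_Icc_self ht)).le
  rw [integral_polynomial_inner_sphereMeasure] at hsphere
  calc
    _ ≤ ε / C * sphereMeasure.real Set.univ + 2 * π * (ε / C * 2) := by
      refine (dist_triangle _ (2 * π * ∫ t in (-1 : ℝ)..1, p.eval t) _).trans
        (add_le_add hsphere ?_)
      rw [dist_eq, ← mul_sub, abs_mul, abs_of_pos two_pi_pos]
      gcongr
    _ = ε / C * C := by rw [hC]; ring
    _ = ε := div_mul_cancel₀ _ hC0.ne'

lemma integral_comp_isometry_sphereMeasure {F : Type*} [NormedAddCommGroup F] [NormedSpace ℝ F]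
    (R : E3 ≃ₗᵢ[ℝ] E3) (f : E3 → F) :
    ∫ u : S2, f (R u) ∂sphereMeasure = ∫ u : S2, f u ∂sphereMeasure := by
  have hRf := integral_norm_smul_normalize (volume : Measure E3)
    (fun r ↦ exp (-r ^ 2)) (fun x ↦ f (R x))
  have hf := integral_norm_smul_normalize (volume : Measure E3) (fun r ↦ exp (-r ^ 2)) f
  rw [← R.measurePreserving.integral_comp R.toHomeomorph.measurableEmbedding] at hf
  simp only [R.norm_map, map_smul] at hf hRf
  have hpos : (∫ r in Set.Ioi (0 : ℝ), r ^ (Module.finrank ℝ E3 - 1) * exp (-r ^ 2)) ≠ 0 := by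
    rw [integral_Ioi_pow_mul_exp_neg_sq]
    exact (half_pos (Gamma_pos_of_pos (by positivity))).ne'
  exact smul_right_injective F hpos (hRf.symm.trans hf)

/-- The first moment of a zonal function points along its axis. -/
lemma integral_comp_inner_smul_sphereMeasure (s : S2) {f : ℝ → ℝ}
    (hf : ContinuousOn f (Set.Icc (-1) 1)) :
    ∫ u : S2, f ⟪(s : E3), (u : E3)⟫ • (u : E3) ∂sphereMeasure =
      (2 * π * ∫ t in (-1 : ℝ)..1, f t * t) • (s : E3) := by
  set I := ∫ u : S2, f ⟪(s : E3), (u : E3)⟫ • (u : E3) ∂sphereMeasure with hI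
  set R := (Submodule.span ℝ {(s : E3)}).reflection
  have hRs : R s = s := (Submodule.reflection_eq_self_iff _).2 (Submodule.mem_span_singleton_self _)
  have hRI : R I = I := by
    have h := integral_comp_isometry_sphereMeasure R (fun x ↦ f ⟪(s : E3), x⟫ • x)
    have hinner : ∀ x, ⟪(s : E3), R x⟫ = ⟪(s : E3), x⟫ := fun x ↦ by
      conv_lhs => rw [← hRs, R.inner_map_map]
    simp only [hinner, ← map_smul] at h
    exact (R.toContinuousLinearEquiv.integral_comp_comm
      fun u : S2 ↦ f ⟪(s : E3), (u : E3)⟫ • (u : E3)).symm.trans h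
  obtain ⟨c, hc⟩ := Submodule.mem_span_singleton.1 ((Submodule.reflection_eq_self_iff _).1 hRI)
  have hcont : Continuous fun u : S2 ↦ f ⟪(s : E3), (u : E3)⟫ • (u : E3) :=
    (continuous_comp_inner hf s).smul continuous_subtype_val
  have hsI : ⟪(s : E3), I⟫ = 2 * π * ∫ t in (-1 : ℝ)..1, f t * t := by
    rw [hI, ← integral_inner (integrable_sphereMeasure hcont),
      ← integral_comp_inner_sphereMeasure s (f := fun t ↦ f t * t) (hf.mul continuousOn_id)]
    simp only [real_inner_smul_right]
  rw [← hsI, ← hc, real_inner_smul_right, real_inner_self_eq_norm_sq, norm_eq_of_mem_sphere s]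
  simp

lemma one_add_sq_sub_two_mul_pos {η t : ℝ} (hη : η ∈ Set.Ioo (-1 : ℝ) 1)
    (ht : t ∈ Set.Icc (-1 : ℝ) 1) : 0 < 1 + η ^ 2 - 2 * η * t := by
  obtain ⟨h₁, h₂⟩ := hη
  obtain ⟨h₃, h₄⟩ := ht
  rcases le_total 0 η with h | h
  · nlinarith [mul_nonneg h (sub_nonneg.2 h₄), pow_pos (sub_pos.2 h₂) 2]
  · nlinarith [mul_nonneg (neg_nonneg.2 h) (neg_le_iff_add_nonneg.1 h₃),
      pow_pos (neg_lt_iff_pos_add.1 h₁) 2]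

lemma continuousOn_henyeyGreenstein_kernel {η : ℝ} (hη : η ∈ Set.Ioo (-1 : ℝ) 1) :
    ContinuousOn (fun t : ℝ ↦ (1 + η ^ 2 - 2 * η * t) ^ (-(3 : ℝ) / 2)) (Set.Icc (-1) 1) :=
  ContinuousOn.rpow_const (by fun_prop) fun _ ht ↦ .inl (one_add_sq_sub_two_mul_pos hη ht).ne'

lemma integral_henyeyGreenstein_kernel_mul_id {η : ℝ} (hη : η ∈ Set.Ioo (-1 : ℝ) 1) :
    ∫ t in (-1 : ℝ)..1, (1 + η ^ 2 - 2 * η * t) ^ (-(3 : ℝ) / 2) * t = 2 * η / (1 - η ^ 2) := by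
  rcases eq_or_ne η 0 with rfl | h0
  · simp
  have hderiv : ∀ t ∈ Set.uIcc (-1 : ℝ) 1, HasDerivAt
      (fun t : ℝ ↦ t * (1 + η ^ 2 - 2 * η * t) ^ (-(1 : ℝ) / 2) / η +
        (1 + η ^ 2 - 2 * η * t) ^ ((1 : ℝ) / 2) / η ^ 2)
      ((1 + η ^ 2 - 2 * η * t) ^ (-(3 : ℝ) / 2) * t) t := by
    intro t ht
    rw [Set.uIcc_of_le (by norm_num)] at ht
    have hu : HasDerivAt (fun t : ℝ ↦ 1 + η ^ 2 - 2 * η * t) (-(2 * η)) t := by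
      simpa using ((hasDerivAt_id t).const_mul (2 * η)).const_sub (1 + η ^ 2)
    have hne := (one_add_sq_sub_two_mul_pos hη ht).ne'
    refine ((((hasDerivAt_id t).mul (hu.rpow_const (p := -(1 : ℝ) / 2) (.inl hne))).div_const
      η).add ((hu.rpow_const (p := (1 : ℝ) / 2) (.inl hne)).div_const (η ^ 2))).congr_deriv ?_
    rw [show -(1 : ℝ) / 2 - 1 = -3 / 2 by norm_num, show (1 : ℝ) / 2 - 1 = -1 / 2 by norm_num]
    simp only [id_eq]
    field_simp
    ring
  rw [intervalIntegral.integral_eq_sub_of_hasDerivAt hderiv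
    (((continuousOn_henyeyGreenstein_kernel hη).mul continuousOn_id).intervalIntegrable_of_Icc
      (by norm_num))]
  have h₁ : 0 < 1 - η := sub_pos.2 hη.2
  have h₂ : 0 < 1 + η := neg_lt_iff_pos_add'.1 hη.1
  have hpow : ∀ {a : ℝ}, 0 < a → (a ^ 2) ^ ((1 : ℝ) / 2) = a ∧ (a ^ 2) ^ (-(1 : ℝ) / 2) = a⁻¹ := by
    intro a ha
    rw [← rpow_natCast, ← rpow_mul ha.le, ← rpow_mul ha.le]
    norm_num [rpow_neg_one]
  rw [show 1 + η ^ 2 - 2 * η * 1 = (1 - η) ^ 2 by ring,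
    show 1 + η ^ 2 - 2 * η * -1 = (1 + η) ^ 2 by ring, (hpow h₁).1, (hpow h₁).2, (hpow h₂).1,
    (hpow h₂).2, show 1 - η ^ 2 = (1 - η) * (1 + η) by ring]
  field_simp
  ring

/-- first moment of the Henyey–Greenstein phase function:
`∫_{S²} Φ(s,s') s' dσ(s') = η s` for every `η ∈ (−1,1)` and every `s ∈ S²`. -/
theorem henyeyGreenstein_first_moment
    (η : ℝ) (hη : η ∈ Set.Ioo (-1 : ℝ) 1) (s : S2) :
    (∫ s', henyeyGreenstein η s s' • (s' : E3) ∂sphereMeasure) = η • (s : E3) := by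
  have h : (1 - η ^ 2) ≠ 0 := by nlinarith [hη.1, hη.2]
  simp only [henyeyGreenstein, mul_smul (1 / (4 * π) * (1 - η ^ 2))]
  rw [integral_smul, integral_comp_inner_smul_sphereMeasure s
    (continuousOn_henyeyGreenstein_kernel hη), integral_henyeyGreenstein_kernel_mul_id hη, smul_smul]
  congr 1
  field_simp
  ring
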